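/- In the late-preemption causal model with binary endogenous variables ST, BT, SH, BH, BS, equations BS = BH ∨ SH, SH = ST, BH = BT ∧ ¬SH, and a context u in which ST=0 and BT=1, it holds that ST=0 NESS-causes BS=1 w.r.t. (M,u), but ST=0 does not BV-cause BS=1 and does not CNESS-cause BS=1 w.r.t. (M,u). -/

import Mathlib

/-!
Structural equation models (causal models) à la Pearl/Halpern, formalizing
Beckers' "The Counterfactual NESS Definition of Causation".

A causal model over a context type `Ctx` (settings of the exogenous variables),
endogenous variables `V` and values `Val` consists of finite nonempty ranges
`R X`, structural equations `F X`, and a strong-recursiveness (acyclicity)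
witness: an order `ord` such that `F X` only depends on variables of lower order.
-/

structure CausalModel (Ctx V Val : Type) where
  R : V → Finset Val
  R_nonempty : ∀ X, (R X).Nonempty
  F : V → Ctx → (V → Val) → Val
  ord : V → ℕ
  F_resp : ∀ X u s s', (∀ Y, ord Y < ord X → s Y = s' Y) → F X u s = F X u s'

namespace CausalModel

variable {Ctx V Val : Type}

/-- The unique solution of the equations in context `u` (it exists and is
unique by strong recursiveness). `(M,u) ⊨ X = x` iff `M.sol u X = x`. -/
noncomputable def sol (M : CausalModel Ctx V Val) (u : Ctx) : V → Val :=
  fun X =>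
    M.F X u (fun Y => if h : M.ord Y < M.ord X then M.sol u Y else (M.R_nonempty Y).choose)
termination_by X => M.ord X
decreasing_by exact h

/-- `M.sol u` indeed solves all the equations. -/
theorem sol_eq (M : CausalModel Ctx V Val) (u : Ctx) (X : V) :
    M.sol u X = M.F X u (M.sol u) := by
  rw [sol]
  exact M.F_resp X u _ _ (fun Y hY => dif_pos hY)

variable [DecidableEq V]

/-- `X⃗ = x⃗` (given by the set `Xs` and the assignment `xs`) is sufficient for
`E = e` w.r.t. `(M, u)`: the equation for `E` outputs `e` on every setting of the
endogenous variables (in their ranges) that agrees with `xs` on `Xs`. -/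
def Sufficient (M : CausalModel Ctx V Val) (u : Ctx) (Xs : Finset V) (xs : V → Val)
    (E : V) (e : Val) : Prop :=
  ∀ s : V → Val, (∀ Y, s Y ∈ M.R Y) → (∀ X ∈ Xs, s X = xs X) → M.F E u s = e

/-- The intervened model `M_{X⃗ ← x⃗}`: the equations of variables in `Xs` are
replaced by the constants given by `xs`. -/
def intervene (M : CausalModel Ctx V Val) (Xs : Finset V) (xs : V → Val) :
    CausalModel Ctx V Val where
  R := M.R
  R_nonempty := M.R_nonempty
  F := fun X u s => if X ∈ Xs then xs X else M.F X u s
  ord := M.ord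
  F_resp := by
    intro X u s s' h
    by_cases hX : X ∈ Xs
    · simp [hX]
    · simpa [hX] using M.F_resp X u s s' h

/-- `W⃗ = w⃗` (given by `Ws, ws`) is a witness for `C = c` directly NESS-causing
`E = e` w.r.t. `(M, u)`: `C = c` and `W⃗ = w⃗` actually hold, `{C = c} ∪ {W⃗ = w⃗}`
is sufficient for `E = e`, and `W⃗ = w⃗` alone is not. -/
def DirectNESSWith (M : CausalModel Ctx V Val) (u : Ctx) (C : V) (c : Val) (E : V) (e : Val)
    (Ws : Finset V) (ws : V → Val) : Prop :=
  M.sol u C = c ∧ (∀ W ∈ Ws, M.sol u W = ws W) ∧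
  M.Sufficient u (insert C Ws) (Function.update ws C c) E e ∧
  ¬ M.Sufficient u Ws ws E e

/-- `C = c` directly NESS-causes `E = e` w.r.t. `(M, u)`. -/
def DirectNESS (M : CausalModel Ctx V Val) (u : Ctx) (C : V) (c : Val) (E : V) (e : Val) :
    Prop :=
  ∃ (Ws : Finset V) (ws : V → Val), M.DirectNESSWith u C c E e Ws ws

/-- `C = c` NESS-causes `E = e` along the path `p = (C₁, …, Cₙ)` w.r.t. `(M, u)`:
there are values `c₁, …, cₙ` such that `C = c` directly NESS-causes `C₁ = c₁`, …,
and `Cₙ = cₙ` directly NESS-causes `E = e`. (A direct NESS-cause is a NESS-cause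
along the empty path.) -/
def NESSAlong (M : CausalModel Ctx V Val) (u : Ctx) (C : V) (c : Val) (p : List V)
    (E : V) (e : Val) : Prop :=
  ∃ cs : List Val, cs.length = p.length ∧
    List.Chain (fun a b => M.DirectNESS u a.1 a.2 b.1 b.2) (C, c) (p.zip cs ++ [(E, e)])

/-- `C = c` NESS-causes `E = e` w.r.t. `(M, u)`: there is a chain of direct
NESS-causes from `C = c` to `E = e`. -/
def NESS (M : CausalModel Ctx V Val) (u : Ctx) (C : V) (c : Val) (E : V) (e : Val) : Prop :=
  ∃ p : List V, M.NESSAlong u C c p E e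

/-- The BV definition: `C = c` NESS-causes `E = e` w.r.t. `(M, u)` and there is a
`c' ∈ R(C)` such that `C = c'` does not NESS-cause `E = e` w.r.t. `(M_{C ← c'}, u)`. -/
def BVCause (M : CausalModel Ctx V Val) (u : Ctx) (C : V) (c : Val) (E : V) (e : Val) :
    Prop :=
  M.NESS u C c E e ∧
    ∃ c' ∈ M.R C, ¬ (M.intervene {C} (fun _ => c')).NESS u C c' E e

/-- The CNESS definition: `C = c` NESS-causes `E = e` along some path `p` w.r.t.
`(M, u)` and there is a `c' ∈ R(C)` such that `C = c'` does not NESS-cause `E = e`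
along any subpath of `p` (a path all of whose variables are in `p`) w.r.t.
`(M_{C ← c'}, u)`. -/
def CNESSCause (M : CausalModel Ctx V Val) (u : Ctx) (C : V) (c : Val) (E : V) (e : Val) :
    Prop :=
  ∃ p : List V, M.NESSAlong u C c p E e ∧
    ∃ c' ∈ M.R C, ∀ p' : List V, (∀ X ∈ p', X ∈ p) →
      ¬ (M.intervene {C} (fun _ => c')).NESSAlong u C c' p' E e

/-- `E = e` is counterfactually dependent on `C = c` w.r.t. `(M, u)`:
`(M,u) ⊨ C = c ∧ E = e` and there is a `c' ∈ R(C)` with `(M,u) ⊨ [C ← c'] ¬(E = e)`. -/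
def CfDep (M : CausalModel Ctx V Val) (u : Ctx) (C : V) (c : Val) (E : V) (e : Val) : Prop :=
  M.sol u C = c ∧ M.sol u E = e ∧
    ∃ c' ∈ M.R C, (M.intervene {C} (fun _ => c')).sol u E ≠ e

/-- `E = e` is counterfactually dependent on `C = c` given the intervention
`X⃗ ← x⃗`: in `M_{X⃗ ← x⃗}` with context `u`, `C = c` and `E = e` hold, and there is
a `c' ∈ R(C)` such that additionally intervening with `C ← c'` makes `E = e` false. -/
def CfDepGiven (M : CausalModel Ctx V Val) (u : Ctx) (Xs : Finset V) (xs : V → Val)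
    (C : V) (c : Val) (E : V) (e : Val) : Prop :=
  (M.intervene Xs xs).sol u C = c ∧ (M.intervene Xs xs).sol u E = e ∧
    ∃ c' ∈ M.R C, ((M.intervene Xs xs).intervene {C} (fun _ => c')).sol u E ≠ e

/-- `Y` is a parent of `X`: the equation `F X` varies with the value of `Y`
for some context and some setting (within the ranges) of the other variables. -/
def Parent (M : CausalModel Ctx V Val) (Y X : V) : Prop :=
  ∃ (u : Ctx) (s : V → Val) (y y' : Val),
    (∀ Z, s Z ∈ M.R Z) ∧ y ∈ M.R Y ∧ y' ∈ M.R Y ∧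
    M.F X u (Function.update s Y y) ≠ M.F X u (Function.update s Y y')

end CausalModel
/-- Variables for the late-preemption model: `ST`, `BT`, `SH`, `BH`, `BS`. -/
inductive VL | ST | BT | SH | BH | BS
deriving DecidableEq

/-- The late-preemption model with equations `BS = BH ∨ SH`, `SH = ST`,
`BH = BT ∧ ¬SH`, in a context where `ST = st0` and `BT = 1`. -/
def ML (st0 : Bool) : CausalModel Unit VL Bool where
  R := fun _ => Finset.univ
  R_nonempty := fun _ => Finset.univ_nonempty
  F := fun X _ s =>
    match X with
    | .ST => st0
    | .BT => true
    | .SH => s .ST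
    | .BH => s .BT && !(s .SH)
    | .BS => s .BH || s .SH
  ord := fun X => match X with | .ST => 0 | .BT => 0 | .SH => 1 | .BH => 2 | .BS => 3
  F_resp := by
    intro X u s s' h
    cases X
    · rfl
    · rfl
    · show s VL.ST = s' VL.ST
      exact h VL.ST (by decide)
    · show (s VL.BT && !(s VL.SH)) = (s' VL.BT && !(s' VL.SH))
      rw [h VL.BT (by decide), h VL.SH (by decide)]
    · show (s VL.BH || s VL.SH) = (s' VL.BH || s' VL.SH)
      rw [h VL.BH (by decide), h VL.SH (by decide)]

theorem ML_intervene (b c : Bool) :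
    (ML b).intervene {VL.ST} (fun _ => c) = ML c := by
  have hF : ((ML b).intervene {VL.ST} (fun _ => c)).F = (ML c).F := by
    funext X u s
    cases X <;> simp [CausalModel.intervene, ML]
  unfold CausalModel.intervene ML at *
  simp only [CausalModel.mk.injEq, true_and, and_true]
  exact hF

theorem ML_sol_ST (b : Bool) : (ML b).sol () VL.ST = b := by
  rw [CausalModel.sol_eq]; rfl

theorem ML_sol_BT (b : Bool) : (ML b).sol () VL.BT = true := by
  rw [CausalModel.sol_eq]; rfl

theorem ML_sol_SH (b : Bool) : (ML b).sol () VL.SH = b := by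
  rw [CausalModel.sol_eq]; exact ML_sol_ST b

theorem ML_sol_BH (b : Bool) : (ML b).sol () VL.BH = !b := by
  rw [CausalModel.sol_eq]
  change ((ML b).sol () VL.BT && !((ML b).sol () VL.SH)) = !b
  rw [ML_sol_BT, ML_sol_SH]; rfl

theorem ML_ST_SH (b : Bool) : (ML b).DirectNESS () VL.ST b VL.SH b := by
  refine ⟨∅, fun _ => b, ML_sol_ST b, by simp, ?_, ?_⟩
  · intro s _ h
    simpa [ML] using h VL.ST (by simp)
  · intro h
    have := h (fun _ => !b) (by simp [ML]) (by simp)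
    simp [ML] at this

theorem ML_SH_BH : (ML false).DirectNESS () VL.SH false VL.BH true := by
  refine ⟨{VL.BT}, fun _ => true, ML_sol_SH _, by simp [ML_sol_BT], ?_, ?_⟩
  · intro s _ h
    have h1 := h VL.SH (by simp)
    have h2 := h VL.BT (by simp)
    simp at h1 h2
    simp [ML, h1, h2]
  · intro h
    have := h (fun _ => true) (by simp [ML]) (by simp)
    simp [ML] at this

theorem ML_BH_BS : (ML false).DirectNESS () VL.BH true VL.BS true := by
  refine ⟨∅, fun _ => true, ML_sol_BH _, by simp, ?_, ?_⟩
  · intro s _ h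
    have h1 := h VL.BH (by simp)
    simp at h1
    simp [ML, h1]
  · intro h
    have := h (fun _ => false) (by simp [ML]) (by simp)
    simp [ML] at this

theorem ML_SH_BS : (ML true).DirectNESS () VL.SH true VL.BS true := by
  refine ⟨∅, fun _ => true, ML_sol_SH _, by simp, ?_, ?_⟩
  · intro s _ h
    have h1 := h VL.SH (by simp)
    simp at h1
    simp [ML, h1]
  · intro h
    have := h (fun _ => false) (by simp [ML]) (by simp)
    simp [ML] at this

theorem ML_ST_only (b c e : Bool) (E : VL) (h : (ML b).DirectNESS () VL.ST c E e) :
    E = VL.SH := by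
  obtain ⟨Ws, ws, h1, h2, h3, h4⟩ := h
  by_contra hE
  apply h4
  intro s _ hs
  have := h3 (Function.update s VL.ST c) (by simp [ML]) (by
    intro X hX
    by_cases hXS : X = VL.ST
    · subst hXS; simp
    · simp only [Function.update_of_ne hXS]
      exact hs X (by simpa [hXS] using hX))
  rw [← this]
  cases E <;> simp_all [ML]

theorem ML_along_false : (ML false).NESSAlong () VL.ST false [VL.SH, VL.BH] VL.BS true := by
  refine ⟨[false, true], rfl, ?_⟩
  simp [List.Chain, ML_ST_SH, ML_SH_BH, ML_BH_BS]

theorem ML_along_true : (ML true).NESSAlong () VL.ST true [VL.SH] VL.BS true := by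
  refine ⟨[true], rfl, ?_⟩
  simp [List.Chain, ML_ST_SH, ML_SH_BS]

theorem ML_along_mem (b : Bool) (p : List VL) (h : (ML b).NESSAlong () VL.ST b p VL.BS true) :
    VL.SH ∈ p := by
  obtain ⟨cs, hl, hc⟩ := h
  cases p with
  | nil =>
    simp [List.Chain] at hc
    exact absurd (ML_ST_only _ _ _ _ hc) (by simp)
  | cons X p =>
    cases cs with
    | nil => simp at hl
    | cons c cs =>
      simp [List.Chain] at hc
      have := ML_ST_only _ _ _ _ hc.1
      simp [this]

/-- In the late-preemption model with context `ST = 0` and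
`BT = 1`, `ST = 0` NESS-causes `BS = 1` w.r.t. `(M, u)`, but `ST = 0` does not
BV-cause `BS = 1` and does not CNESS-cause `BS = 1` w.r.t. `(M, u)`. -/
theorem suzy_not_throwing :
    (ML false).NESS () VL.ST false VL.BS true ∧
      ¬ (ML false).BVCause () VL.ST false VL.BS true ∧
      ¬ (ML false).CNESSCause () VL.ST false VL.BS true := by
  refine ⟨⟨_, ML_along_false⟩, ?_, ?_⟩
  · rintro ⟨-, c, -, h⟩
    rw [ML_intervene] at h
    cases c
    · exact h ⟨_, ML_along_false⟩
    · exact h ⟨_, ML_along_true⟩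
  · rintro ⟨p, hp, c, -, h⟩
    rw [ML_intervene] at h
    cases c
    · exact h p (fun _ hX => hX) hp
    · exact h [VL.SH] (by simpa using ML_along_mem _ _ hp) ML_along_true
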